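/- Let n ≥ 2, let p₀, p₁ ≥ 0 with p₀ + p₁ = 1, and let ψ₀, ψ₁ ∈ EuclideanSpace ℂ (Fin n) be unit vectors. Define the bipartite pure state Ψ : Fin n × Fin 2 → ℂ by Ψ(i,k) = √(p_k) · ψ_k(i). Then there exist orthonormal vectors η₊, η₋ ∈ EuclideanSpace ℂ (Fin n) such that for each s ∈ {+,−} and each k ∈ {0,1}, |Σ_{i} conj(η_s(i)) · Ψ(i,k)|² = p_k / 2. (In particular each measurement outcome s occurs with probability 1/2, and each normalized post-measurement state φ_s of the qubit satisfies |φ_s(k)|² = p_k, so it carries the maximal coherence S(Δ(ρ^B)).) -/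

import Mathlib

theorem aux_orth (n : ℕ) (hn : 2 ≤ n) (u v : EuclideanSpace ℂ (Fin n)) (hu : ‖u‖ = 1) :
    ∃ (e : EuclideanSpace ℂ (Fin n)) (a b : ℂ), ‖e‖ = 1 ∧ inner ℂ u e = 0 ∧ v = a • u + b • e := by
  have huu : inner ℂ u u = (1 : ℂ) := by
    rw [inner_self_eq_norm_sq_to_K, hu]; simp
  by_cases h : v - (inner ℂ u v : ℂ) • u = 0
  · have hne : (Submodule.span ℂ {u})ᗮ ≠ ⊥ := by
      intro hb
      rw [Submodule.orthogonal_eq_bot_iff] at hb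
      have h1 := finrank_span_le_card (R := ℂ) ({u} : Set (EuclideanSpace ℂ (Fin n)))
      rw [hb, finrank_top, finrank_euclideanSpace_fin] at h1
      simp at h1
      omega
    obtain ⟨w, hw, hw0⟩ := Submodule.exists_mem_ne_zero_of_ne_bot hne
    rw [Submodule.mem_orthogonal_singleton_iff_inner_right] at hw
    refine ⟨((‖w‖⁻¹ : ℝ) : ℂ) • w, inner ℂ u v, 0, ?_, ?_, ?_⟩
    · simp [norm_smul, hw0]
    · simp [inner_smul_right, hw]
    · simpa using sub_eq_zero.1 h
  · set w := v - (inner ℂ u v : ℂ) • u with hwd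
    refine ⟨((‖w‖⁻¹ : ℝ) : ℂ) • w, inner ℂ u v, (‖w‖ : ℂ), ?_, ?_, ?_⟩
    · simp [norm_smul, h]
    · rw [inner_smul_right, hwd, inner_sub_right, inner_smul_right, huu]; simp
    · have : (‖w‖ : ℂ) ≠ 0 := by simpa using h
      rw [smul_smul]
      push_cast
      rw [mul_inv_cancel₀ this, one_smul, hwd]; abel

theorem aux_phase (z : ℂ) : ∃ ω : ℂ, ‖ω‖ = 1 ∧ (z * (starRingEnd ℂ) ω).re = 0 := by
  by_cases h : z = 0
  · exact ⟨1, by simp, by simp [h]⟩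
  · refine ⟨Complex.I * z * ((‖z‖⁻¹ : ℝ) : ℂ), by simp [h], ?_⟩
    simp only [map_mul, Complex.conj_ofReal, Complex.conj_I]
    simp [Complex.mul_re, Complex.mul_im]
    ring

theorem aux_main (n : ℕ) (hn : 2 ≤ n) (u v : EuclideanSpace ℂ (Fin n)) (hu : ‖u‖ = 1)
    (hv : ‖v‖ = 1) :
    ∃ η : Fin 2 → EuclideanSpace ℂ (Fin n), Orthonormal ℂ η ∧
      ∀ s, ‖(inner ℂ (η s) u : ℂ)‖ ^ 2 = 1 / 2 ∧ ‖(inner ℂ (η s) v : ℂ)‖ ^ 2 = 1 / 2 := by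
  obtain ⟨e, a, b, he, hue, hvv⟩ := aux_orth n hn u v hu
  obtain ⟨ω, hω, hz⟩ := aux_phase ((starRingEnd ℂ) a * b)
  have huu : inner ℂ u u = (1 : ℂ) := by
    rw [inner_self_eq_norm_sq_to_K, hu]; simp
  have hee : inner ℂ e e = (1 : ℂ) := by
    rw [inner_self_eq_norm_sq_to_K, he]; simp
  have heu : inner ℂ e u = (0 : ℂ) := by
    rw [← inner_conj_symm, hue]; simp
  have hww : (starRingEnd ℂ) ω * ω = 1 := by
    rw [mul_comm, Complex.mul_conj, Complex.normSq_eq_norm_sq, hω]; simp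
  have hw2 : ω.re * ω.re + ω.im * ω.im = 1 := by
    have := Complex.normSq_eq_norm_sq ω
    rw [hω, Complex.normSq_apply] at this; linarith
  have hab : (starRingEnd ℂ) a * a + (starRingEnd ℂ) b * b = 1 := by
    have : inner ℂ v v = (1 : ℂ) := by
      rw [inner_self_eq_norm_sq_to_K, hv]; simp
    rw [hvv] at this
    simp only [inner_add_left, inner_add_right, inner_smul_left, inner_smul_right, huu, hee, heu,
      hue] at this
    linear_combination this
  have hab2 : a.re * a.re + a.im * a.im + (b.re * b.re + b.im * b.im) = 1 := by
    have := congrArg Complex.re hab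
    simp at this; linarith
  obtain ⟨c, hc⟩ : ∃ c : ℝ, c * c = 1 / 2 := ⟨√(1/2), Real.mul_self_sqrt (by norm_num)⟩
  have hcC : (c : ℂ) * c = 1 / 2 := by rw [← Complex.ofReal_mul, hc]; simp
  let σ : Fin 2 → ℝ := ![1, -1]
  have hσ : ∀ s, σ s * σ s = 1 := by intro s; fin_cases s <;> simp [σ]
  have key : ∀ s t, inner ℂ ((c : ℂ) • (u + ((σ s : ℂ) * ω) • e))
      ((c : ℂ) • (u + ((σ t : ℂ) * ω) • e)) = ((1 : ℂ) + σ s * σ t) / 2 := by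
    intro s t
    simp only [inner_add_left, inner_add_right, inner_smul_left, inner_smul_right, huu, hee, heu,
      hue, map_mul, Complex.conj_ofReal]
    linear_combination (1 + (σ s : ℂ) * σ t) * hcC + (c : ℂ) * c * σ s * σ t * hww
  refine ⟨fun s => (c : ℂ) • (u + ((σ s : ℂ) * ω) • e), ?_, ?_⟩
  · rw [orthonormal_iff_ite]
    intro i j
    rw [key]
    fin_cases i <;> fin_cases j <;> simp [σ]
  · intro s
    have h1 : inner ℂ ((c : ℂ) • (u + ((σ s : ℂ) * ω) • e)) u = (c : ℂ) := by
      simp only [inner_add_left, inner_smul_left, huu, heu, Complex.conj_ofReal]; ring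
    have h2 : inner ℂ ((c : ℂ) • (u + ((σ s : ℂ) * ω) • e)) v =
        (c : ℂ) * (a + σ s * ((starRingEnd ℂ) ω * b)) := by
      rw [hvv]
      simp only [inner_add_left, inner_add_right, inner_smul_left, inner_smul_right, huu, hee, heu,
        hue, map_mul, Complex.conj_ofReal]
      ring
    constructor
    · show ‖(inner ℂ ((c : ℂ) • (u + ((σ s : ℂ) * ω) • e)) u : ℂ)‖ ^ 2 = _
      rw [h1, ← Complex.normSq_eq_norm_sq, Complex.normSq_ofReal, hc]
    · show ‖(inner ℂ ((c : ℂ) • (u + ((σ s : ℂ) * ω) • e)) v : ℂ)‖ ^ 2 = _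
      rw [h2, ← Complex.normSq_eq_norm_sq, Complex.normSq_mul, Complex.normSq_ofReal, hc,
        Complex.normSq_add, Complex.normSq_mul, Complex.normSq_mul, Complex.normSq_ofReal, hσ,
        Complex.normSq_conj]
      have h3 : (a * (starRingEnd ℂ) ((σ s : ℂ) * ((starRingEnd ℂ) ω * b))).re = 0 := by
        have : (a * (starRingEnd ℂ) ((σ s : ℂ) * ((starRingEnd ℂ) ω * b))).re
          = σ s * ((starRingEnd ℂ) a * b * (starRingEnd ℂ) ω).re := by
          simp; ring
        rw [this, hz, mul_zero]
      rw [h3]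
      simp only [Complex.normSq_apply]
      rw [hw2]
      linear_combination (1/2) * hab2

/-- Let `n ≥ 2`, let `p 0, p 1 ≥ 0` with `p 0 + p 1 = 1`, and let
`ψ 0, ψ 1 ∈ ℂⁿ` be unit vectors.  Consider the bipartite pure state
`Ψ (i,k) = √(p k) · ψ k i` of a system `A` of dimension `n` and a qubit `B`.
Then there exists an orthonormal pair `η 0, η 1` (Alice's measurement basis,
playing the role of `η₊, η₋`) such that for each outcome `s` and each incoherent
basis index `k`, `|Σ_i conj (η s i) * Ψ (i,k)|² = p k / 2`. -/
theorem exists_assisting_measurement_qubit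
    (n : ℕ) (hn : 2 ≤ n) (p : Fin 2 → ℝ) (hp : ∀ k, 0 ≤ p k)
    (hpsum : p 0 + p 1 = 1)
    (ψ : Fin 2 → EuclideanSpace ℂ (Fin n)) (hψ : ∀ k, ‖ψ k‖ = 1)
    (Ψ : Fin n × Fin 2 → ℂ)
    (hΨ : ∀ i k, Ψ (i, k) = (Real.sqrt (p k) : ℂ) * ψ k i) :
    ∃ η : Fin 2 → EuclideanSpace ℂ (Fin n), Orthonormal ℂ η ∧
      ∀ s k : Fin 2,
        ‖∑ i : Fin n, (starRingEnd ℂ) (η s i) * Ψ (i, k)‖ ^ 2 = p k / 2 := by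
  obtain ⟨η, ho, h⟩ := aux_main n hn (ψ 0) (ψ 1) (hψ 0) (hψ 1)
  refine ⟨η, ho, fun s k => ?_⟩
  have hk : ‖(inner ℂ (η s) (ψ k) : ℂ)‖ ^ 2 = 1 / 2 := by
    fin_cases k
    · exact (h s).1
    · exact (h s).2
  have hs : ∑ i : Fin n, (starRingEnd ℂ) (η s i) * Ψ (i, k)
      = (Real.sqrt (p k) : ℂ) * inner ℂ (η s) (ψ k) := by
    rw [PiLp.inner_apply, Finset.mul_sum]
    refine Finset.sum_congr rfl fun i _ => ?_
    rw [hΨ, RCLike.inner_apply]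
    ring
  rw [hs, norm_mul, mul_pow, hk, Complex.norm_real, Real.norm_eq_abs, sq_abs, Real.sq_sqrt (hp k)]
  ring
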